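/- arXiv:1508.06772 — 2 statements merged into one kernel-verified Lean document; each statement's English description precedes it below -/
import Mathlib

section
/- Let T be a densely defined self-adjoint operator on a complex Hilbert space H with bounded transform S. For the identity function id(x) = x on σ(T), the operator id₀(T), defined on C*_c(S)H by id₀(T) h(T)ψ = (id·h)(T)ψ for h ∈ C_c(σ(T)), has closure equal to T; i.e., id(T) = T. -/
noncomputable section

variable {H : Type*} [NormedAddCommGroup H] [InnerProductSpace ℂ H] [CompleteSpace H]

/-- `S = T(I + T²)^{-1/2}`, the *bounded transform* of the (possibly unbounded) operator `T`.
This is witnessed by `C = (I + T²)⁻¹` (a positive bounded operator mapping into the domain of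
`T²` with `(I + T²) ∘ C = I`, which determines `C` uniquely when `T` is self-adjoint) together
with its (unique) positive square root `R = (I + T²)^{-1/2}`, and `S = T ∘ R`. -/
def IsBoundedTransform (T : H →ₗ.[ℂ] H) (S : H →L[ℂ] H) : Prop :=
  ∃ C R : H →L[ℂ] H, C.IsPositive ∧ R.IsPositive ∧ R * R = C ∧
    (∀ x : H, ∃ (h1 : C x ∈ T.domain) (h2 : (T ⟨C x, h1⟩ : H) ∈ T.domain),
        C x + T ⟨(T ⟨C x, h1⟩ : H), h2⟩ = x) ∧
    (∀ x : H, ∃ hx : R x ∈ T.domain, S x = T ⟨R x, hx⟩)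

/-- `S` is a pure contraction: `‖Sx‖ < ‖x‖` for all `x ≠ 0`. -/
def PureContraction (S : H →L[ℂ] H) : Prop := ∀ x : H, x ≠ 0 → ‖S x‖ < ‖x‖

/-- `T = S(I - S²)^{-1/2}`: witnessed by the (unique) positive square root `R` of `I - S²`,
with `D(T) = ran R` and `T ∘ R = S`. -/
def IsInverseBoundedTransform (S : H →L[ℂ] H) (T : H →ₗ.[ℂ] H) : Prop :=
  ∃ R : H →L[ℂ] H, R.IsPositive ∧ R * R = 1 - S * S ∧
    (T.domain : Set H) = Set.range R ∧
    (∀ x : H, ∃ hx : R x ∈ T.domain, (T ⟨R x, hx⟩ : H) = S x)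

/-- The resolvent set of an unbounded operator: `z` such that `T - z` has a (bounded,
everywhere defined) two-sided inverse. -/
def pmapResolventSet (T : H →ₗ.[ℂ] H) : Set ℂ :=
  {z | ∃ B : H →L[ℂ] H,
    (∀ x : H, ∃ h : B x ∈ T.domain, (T ⟨B x, h⟩ : H) - z • B x = x) ∧
    (∀ ψ : T.domain, B ((T ψ : H) - z • (ψ : H)) = ψ)}

/-- The spectrum of an unbounded operator. -/
def pmapSpectrum (T : H →ₗ.[ℂ] H) : Set ℂ := (pmapResolventSet T)ᶜ

/-- The real points of the spectrum of `T` (all of them, if `T` is self-adjoint). -/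
def realSpec (T : H →ₗ.[ℂ] H) : Set ℝ := {x : ℝ | (x : ℂ) ∈ pmapSpectrum T}

/-- `g(S)` for a function `g : ℝ → ℂ`, via the continuous functional calculus of `S`. -/
def boundedCalc (S : H →L[ℂ] H) (g : ℝ → ℂ) : H →L[ℂ] H :=
  cfc (fun z : ℂ => g z.re) S

/-- The homeomorphism `u : (-1,1) → ℝ`, `u(x) = x(1 - x²)^{-1/2}`. -/
def uFun : ℝ → ℝ := fun x => x / Real.sqrt (1 - x ^ 2)

/-- `h ∘ u`, extended by `0` outside `(-1,1)`. -/
def compU (h : ℝ → ℂ) : ℝ → ℂ :=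
  fun x => if x ∈ Set.Ioo (-1 : ℝ) 1 then h (uFun x) else 0

/-- `h(T) := (h ∘ u)(S)`, for a function `h` on `σ(T)`, where `S` is the bounded
transform of `T`. -/
def pmapCalc (S : H →L[ℂ] H) (h : ℝ → ℂ) : H →L[ℂ] H := boundedCalc S (compU h)

/-- `σ̃(S) = σ(S) ∩ (-1,1)`. -/
def tildeSpec (S : H →L[ℂ] H) : Set ℝ := spectrum ℝ S ∩ Set.Ioo (-1) 1

/-- `g ∈ C_c(Ω)`: continuous on `Ω`, vanishing outside a compact subset of `Ω`
(functions on `Ω` are encoded as functions on `ℝ` vanishing identically outside `Ω`). -/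
def MemCc (g : ℝ → ℂ) (Ω : Set ℝ) : Prop :=
  ContinuousOn g Ω ∧ ∃ K : Set ℝ, IsCompact K ∧ K ⊆ Ω ∧ ∀ x ∉ K, g x = 0

/-- `g ∈ C₀(Ω)`: continuous on `Ω` and vanishing at infinity on `Ω`. -/
def MemC0 (g : ℝ → ℂ) (Ω : Set ℝ) : Prop :=
  ContinuousOn g Ω ∧ (∀ x ∉ Ω, g x = 0) ∧
    ∀ ε > 0, ∃ K : Set ℝ, IsCompact K ∧ K ⊆ Ω ∧ ∀ x ∈ Ω \ K, ‖g x‖ < ε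

/-- `g ∈ C_b(Ω)`: continuous and bounded on `Ω`. -/
def MemCb (g : ℝ → ℂ) (Ω : Set ℝ) : Prop :=
  ContinuousOn g Ω ∧ ∃ M : ℝ, ∀ x ∈ Ω, ‖g x‖ ≤ M

/-- The supremum norm `‖f‖_∞` of `f` over `Ω`. -/
def supNorm (f : ℝ → ℂ) (Ω : Set ℝ) : ℝ := sSup ((fun x => ‖f x‖) '' Ω)

/-- The subspace `C*_c(S)H`: the linear span of all `g(S)ψ` with `g ∈ C_c(σ̃(S))`. -/
def ccSpan (S : H →L[ℂ] H) : Submodule ℂ H :=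
  Submodule.span ℂ
    {v : H | ∃ g : ℝ → ℂ, MemCc g (tildeSpec S) ∧ ∃ ψ : H, v = boundedCalc S g ψ}

/-- The subspace `C*₀(S)H`: the linear span of all `g(S)ψ` with `g ∈ C₀(σ̃(S))`. -/
def c0Span (S : H →L[ℂ] H) : Submodule ℂ H :=
  Submodule.span ℂ
    {v : H | ∃ g : ℝ → ℂ, MemC0 g (tildeSpec S) ∧ ∃ ψ : H, v = boundedCalc S g ψ}

/-- `TR ⊂ RT`: the bounded operator `R` commutes with the unbounded operator `T`. -/
def CommutesPMap (T : H →ₗ.[ℂ] H) (R : H →L[ℂ] H) : Prop :=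
  ∀ ψ : T.domain, ∃ h : R (ψ : H) ∈ T.domain, (T ⟨R (ψ : H), h⟩ : H) = R (T ψ)

/-- `A = f₀(T)`: the operator with domain `C*_c(S)H` determined by
`f₀(T) h(T)ψ = (fh)(T)ψ` for `h ∈ C_c(σ(T))` (where `σT` is the spectrum of `T`,
and `h(T) = (h∘u)(S)`). -/
def IsF0 (S : H →L[ℂ] H) (σT : Set ℝ) (f : ℝ → ℂ) (A : H →ₗ.[ℂ] H) : Prop :=
  A.domain = ccSpan S ∧
  ∀ h : ℝ → ℂ, MemCc h σT → ∀ ψ : H,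
    ∃ hm : pmapCalc S h ψ ∈ A.domain,
      A ⟨pmapCalc S h ψ, hm⟩ = pmapCalc S (fun x => f x * h x) ψ

open scoped InnerProductSpace

/-- A self-adjoint unbounded operator is symmetric. -/
lemma LinearPMap.inner_apply_left_of_isSelfAdjoint {T : H →ₗ.[ℂ] H} (hsa : IsSelfAdjoint T)
    (x y : T.domain) : ⟪T x, (y : H)⟫_ℂ = ⟪(x : H), T y⟫_ℂ := by
  have h := LinearPMap.adjoint_isFormalAdjoint hsa.dense_domain
  rw [LinearPMap.isSelfAdjoint_def.mp hsa] at h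
  exact h x y

lemma ContinuousLinearMap.IsPositive.eq_of_mul_self_eq {P Q : H →L[ℂ] H} (hP : P.IsPositive)
    (hQ : Q.IsPositive) (h : P * P = Q * Q) : P = Q :=
  (CFC.mul_self_eq_mul_self_iff P Q (nonneg_iff_isPositive P |>.mpr hP)
    (nonneg_iff_isPositive Q |>.mpr hQ)).mp h

/-- An operator commuting with the square of a positive operator commutes with the operator. -/
lemma ContinuousLinearMap.IsPositive.commute_of_commute_mul_self {R B : H →L[ℂ] H}
    (hR : R.IsPositive) (h : Commute (R * R) B) : Commute R B := by
  rw [← CFC.sqrt_mul_self R (nonneg_iff_isPositive R |>.mpr hR)]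
  exact h.cfcₙ_nnreal _

/-- The bounded transform `S` of a self-adjoint operator `T` is self-adjoint, and
`T = S(I - S²)^{-1/2}`. -/
lemma IsBoundedTransform.isSelfAdjoint_and_inverse {T : H →ₗ.[ℂ] H} {S : H →L[ℂ] H}
    (hsa : IsSelfAdjoint T) (hbt : IsBoundedTransform T S) :
    IsSelfAdjoint S ∧ IsInverseBoundedTransform S T := by
  obtain ⟨C, R, hC, hR, hRR, hTC, hTR⟩ := hbt
  have hsymm := LinearPMap.inner_apply_left_of_isSelfAdjoint hsa
  have hRs : ∀ x y, ⟪R x, y⟫_ℂ = ⟪x, R y⟫_ℂ := hR.isSymmetric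
  have hCs : ∀ x y, ⟪C x, y⟫_ℂ = ⟪x, C y⟫_ℂ := hC.isSymmetric
  have hRRx : ∀ x, R (R x) = C x := fun x => congrArg (· x) hRR
  have hTCS : ∀ x (h : C x ∈ T.domain), T ⟨C x, h⟩ = S (R x) := by
    intro x h
    obtain ⟨hx, e⟩ := hTR (R x)
    rw [e]
    congr 2
    exact (hRRx x).symm
  have hTTC : ∀ x, ∃ h : S (R x) ∈ T.domain, C x + T ⟨S (R x), h⟩ = x := by
    intro x
    obtain ⟨h1, h2, h3⟩ := hTC x
    have e := hTCS x h1
    refine ⟨e ▸ h2, ?_⟩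
    convert h3 using 4
    exact e.symm
  have hCd : ∀ x, C x ∈ T.domain := fun x => (hTC x).1
  have hCinj : ∀ x, C x = 0 → x = 0 := by
    intro x hx
    obtain ⟨h1, h2, h3⟩ := hTC x
    have e : (⟨C x, h1⟩ : T.domain) = 0 := Subtype.ext hx
    have e2 : (⟨T ⟨C x, h1⟩, h2⟩ : T.domain) = 0 := Subtype.ext (by simp [e])
    rw [← h3, e2, hx]
    simp
  have hRinj : ∀ x, R x = 0 → x = 0 := fun x hx => hCinj x (by rw [← hRRx, hx, map_zero])
  have hRdense : DenseRange R := by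
    have h : R.rangeᗮ = ⊥ := by
      rw [ContinuousLinearMap.orthogonal_range, hR.isSelfAdjoint.adjoint_eq]
      exact LinearMap.ker_eq_bot'.mpr hRinj
    exact (Submodule.dense_iff_topologicalClosure_eq_top.mpr
      ((Submodule.topologicalClosure_eq_top_iff).mpr h))
  have hext : ∀ x y : H, (∀ z, ⟪x, R z⟫_ℂ = ⟪y, R z⟫_ℂ) → x = y := fun x y h =>
    ext_inner_right ℂ fun v => congrFun (hRdense.equalizer
      (continuous_const.inner continuous_id) (continuous_const.inner continuous_id)
      (funext h)) v
  have hTCsymm : ∀ x y, ⟪S (R x), y⟫_ℂ = ⟪x, S (R y)⟫_ℂ := by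
    intro x y
    obtain ⟨hx, ex⟩ := hTTC x
    obtain ⟨hy, ey⟩ := hTTC y
    have h1 := hsymm ⟨_, hx⟩ ⟨_, hy⟩
    have h2 := hsymm ⟨_, hCd x⟩ ⟨_, hy⟩
    have h3 := hsymm ⟨_, hx⟩ ⟨_, hCd y⟩
    have h4 := hsymm ⟨_, hCd x⟩ ⟨_, hCd y⟩
    simp only [hTCS] at h1 h2 h3 h4
    conv_lhs => rw [← ey]
    conv_rhs => rw [← ex]
    rw [inner_add_left, inner_add_right, h4, h1]
  have hB : IsSelfAdjoint (S * R) :=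
    ContinuousLinearMap.isSelfAdjoint_iff_isSymmetric.mpr hTCsymm
  have hcomm : Commute C (S * R) := by
    ext x
    refine ext_inner_right ℂ fun y => ?_
    change ⟪C (S (R x)), y⟫_ℂ = ⟪S (R (C x)), y⟫_ℂ
    have := hsymm ⟨_, hCd x⟩ ⟨_, hCd y⟩
    simp only [hTCS] at this
    rw [hCs, this, ← hTCsymm]
  have hcomm' : Commute R (S * R) := hR.commute_of_commute_mul_self (hRR ▸ hcomm)
  have hSR : ∀ x, R (S x) = S (R x) := fun x =>
    congrFun (hRdense.equalizer (R.continuous.comp S.continuous) (S.continuous.comp R.continuous)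
      (funext fun z => congrArg (· z) hcomm'.eq)) x
  have hSs : ∀ x y, ⟪S x, y⟫_ℂ = ⟪x, S y⟫_ℂ := fun x y =>
    congrFun (hRdense.equalizer (g := fun y => ⟪S x, y⟫_ℂ) (h := fun y => ⟪x, S y⟫_ℂ)
      (continuous_const.inner continuous_id) (continuous_const.inner S.continuous)
      (funext fun z => by
        change ⟪S x, R z⟫_ℂ = ⟪x, S (R z)⟫_ℂ
        rw [← hRs, hSR, hTCsymm])) y
  refine ⟨ContinuousLinearMap.isSelfAdjoint_iff_isSymmetric.mpr hSs, R, hR, ?_, ?_, ?_⟩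
  · rw [hRR]
    ext x
    refine hext _ _ fun z => ?_
    obtain ⟨hx, ex⟩ := hTR x
    obtain ⟨hz, ez⟩ := hTTC z
    have h := hsymm ⟨_, hx⟩ ⟨_, hz⟩
    rw [← ex, eq_sub_of_add_eq' ez, hRs] at h
    change ⟪C x, R z⟫_ℂ = ⟪x - S (S x), R z⟫_ℂ
    rw [inner_sub_left, hSs (S x), h, ← inner_sub_right, map_sub, sub_sub_cancel, hCs,
      ← hRRx, ← hRRx]
  · refine Set.Subset.antisymm (fun ψ hψ => ⟨R ψ + S (T ⟨ψ, hψ⟩), ?_⟩) ?_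
    · refine ext_inner_right ℂ fun y => ?_
      obtain ⟨hy, ey⟩ := hTTC y
      have h := hsymm ⟨ψ, hψ⟩ ⟨_, hy⟩
      rw [hRs, inner_add_left, hRs, hRRx, hSs, h, ← inner_add_right, ey]
    · rintro _ ⟨x, rfl⟩
      exact (hTR x).1
  · intro x
    obtain ⟨hx, ex⟩ := hTR x
    exact ⟨hx, ex.symm⟩

lemma IsSelfAdjoint.re_mem_real_spectrum {S : H →L[ℂ] H} (hS : IsSelfAdjoint S) {z : ℂ}
    (hz : z ∈ spectrum ℂ S) : z.re ∈ spectrum ℝ S := by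
  rw [← hS.spectrumRestricts.image]
  exact ⟨z, hz, rfl⟩

lemma IsSelfAdjoint.continuousOn_comp_re {S : H →L[ℂ] H} (hS : IsSelfAdjoint S) {g : ℝ → ℂ}
    (hg : ContinuousOn g (spectrum ℝ S)) :
    ContinuousOn (fun z : ℂ => g z.re) (spectrum ℂ S) :=
  hg.comp Complex.continuous_re.continuousOn fun _ hz => hS.re_mem_real_spectrum hz

lemma boundedCalc_congr {S : H →L[ℂ] H} (hS : IsSelfAdjoint S) {f g : ℝ → ℂ}
    (h : Set.EqOn f g (spectrum ℝ S)) : boundedCalc S f = boundedCalc S g :=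
  cfc_congr fun _ hz => h (hS.re_mem_real_spectrum hz)

lemma boundedCalc_mul {S : H →L[ℂ] H} (hS : IsSelfAdjoint S) {f g : ℝ → ℂ}
    (hf : ContinuousOn f (spectrum ℝ S)) (hg : ContinuousOn g (spectrum ℝ S)) :
    boundedCalc S (fun x => f x * g x) = boundedCalc S f * boundedCalc S g :=
  cfc_mul _ _ S (hS.continuousOn_comp_re hf) (hS.continuousOn_comp_re hg)

lemma boundedCalc_sub {S : H →L[ℂ] H} (hS : IsSelfAdjoint S) {f g : ℝ → ℂ}
    (hf : ContinuousOn f (spectrum ℝ S)) (hg : ContinuousOn g (spectrum ℝ S)) :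
    boundedCalc S (fun x => f x - g x) = boundedCalc S f - boundedCalc S g :=
  cfc_sub _ _ S (hS.continuousOn_comp_re hf) (hS.continuousOn_comp_re hg)

lemma boundedCalc_const_mul {S : H →L[ℂ] H} (hS : IsSelfAdjoint S) (c : ℂ) {f : ℝ → ℂ}
    (hf : ContinuousOn f (spectrum ℝ S)) :
    boundedCalc S (fun x => c * f x) = c • boundedCalc S f :=
  cfc_const_mul c _ S (hS.continuousOn_comp_re hf)

lemma boundedCalc_ofReal {S : H →L[ℂ] H} (hS : IsSelfAdjoint S) :
    boundedCalc S (fun x => (x : ℂ)) = S := by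
  have := hS.isStarNormal
  conv_rhs => rw [← cfc_id' ℂ S]
  exact cfc_congr fun z hz => (hS.mem_spectrum_eq_re hz).symm

lemma boundedCalc_one {S : H →L[ℂ] H} (hS : IsSelfAdjoint S) :
    boundedCalc S (fun _ => 1) = 1 :=
  have := hS.isStarNormal
  cfc_const_one ℂ S

lemma isUnit_boundedCalc_iff {S : H →L[ℂ] H} (hS : IsSelfAdjoint S) {f : ℝ → ℂ}
    (hf : ContinuousOn f (spectrum ℝ S)) :
    IsUnit (boundedCalc S f) ↔ ∀ x ∈ spectrum ℝ S, f x ≠ 0 := by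
  have := hS.isStarNormal
  rw [boundedCalc, isUnit_cfc_iff _ S (hS.continuousOn_comp_re hf)]
  refine ⟨fun h x hx => ?_, fun h z hz => h _ (hS.re_mem_real_spectrum hz)⟩
  exact h (x : ℂ) (spectrum.algebraMap_mem ℂ hx)

/-- The real function `x ↦ √(1 - x²)`, viewed as complex-valued. -/
def sqrtOneSubSq (x : ℝ) : ℂ := (Real.sqrt (1 - x ^ 2) : ℂ)

lemma continuous_sqrtOneSubSq : Continuous sqrtOneSubSq := by
  unfold sqrtOneSubSq; fun_prop

lemma sqrtOneSubSq_ne_zero {x : ℝ} (hx : x ∈ Set.Ioo (-1 : ℝ) 1) : sqrtOneSubSq x ≠ 0 := by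
  have : 0 < 1 - x ^ 2 := by nlinarith [hx.1, hx.2]
  exact Complex.ofReal_ne_zero.mpr (Real.sqrt_pos.mpr this).ne'

lemma ofReal_uFun (x : ℝ) : (uFun x : ℂ) = x / sqrtOneSubSq x := by
  simp [uFun, sqrtOneSubSq]

lemma continuousOn_uFun : ContinuousOn uFun (Set.Ioo (-1) 1) := by
  refine continuousOn_id.div (by fun_prop) fun x hx => ?_
  exact Complex.ofReal_ne_zero.mp (sqrtOneSubSq_ne_zero hx)

lemma real_spectrum_subset_Icc {S R : H →L[ℂ] H} (hS : IsSelfAdjoint S) (hR : IsSelfAdjoint R)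
    (hRS : R * R = 1 - S * S) : spectrum ℝ S ⊆ Set.Icc (-1) 1 := by
  have hle : ‖S‖ ≤ 1 := by
    refine S.opNorm_le_bound zero_le_one fun x => ?_
    have h1 : ⟪S x, S x⟫_ℂ = ⟪x, x⟫_ℂ - ⟪R x, R x⟫_ℂ := by
      have hx : R (R x) = x - S (S x) := congrArg (· x) hRS
      have e1 := (ContinuousLinearMap.isSelfAdjoint_iff_isSymmetric.mp hR) x (R x)
      have e2 := (ContinuousLinearMap.isSelfAdjoint_iff_isSymmetric.mp hS) x (S x)
      simp only [ContinuousLinearMap.coe_coe] at e1 e2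
      rw [e1, e2, hx, inner_sub_right, sub_sub_cancel]
    simp only [inner_self_eq_norm_sq_to_K] at h1
    have h2 : ‖S x‖ ^ 2 = ‖x‖ ^ 2 - ‖R x‖ ^ 2 := by exact_mod_cast h1
    rw [one_mul]
    exact (sq_le_sq₀ (norm_nonneg _) (norm_nonneg _)).mp (by nlinarith [sq_nonneg ‖R x‖])
  intro x hx
  have h := (spectrum.norm_le_norm_mul_of_mem hx).trans
    (mul_le_one₀ hle (norm_nonneg _) ContinuousLinearMap.norm_id_le)
  exact abs_le.mp h

open scoped ComplexOrder in
lemma eq_boundedCalc_sqrtOneSubSq {S R : H →L[ℂ] H} (hS : IsSelfAdjoint S) (hR : R.IsPositive)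
    (hRS : R * R = 1 - S * S) : R = boundedCalc S sqrtOneSubSq := by
  refine hR.eq_of_mul_self_eq ?_ ?_
  · rw [← ContinuousLinearMap.nonneg_iff_isPositive]
    exact cfc_nonneg fun z _ => Complex.zero_le_real.mpr (Real.sqrt_nonneg _)
  · have hid : Continuous fun x : ℝ => (x : ℂ) := Complex.continuous_ofReal
    rw [hRS, ← boundedCalc_mul hS continuous_sqrtOneSubSq.continuousOn
      continuous_sqrtOneSubSq.continuousOn]
    have h1 : boundedCalc S (fun x => 1 - (x : ℂ) * x) = 1 - S * S := by
      rw [boundedCalc_sub (g := fun x : ℝ => (x : ℂ) * x) hS continuousOn_const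
        (hid.mul hid).continuousOn, boundedCalc_one hS, boundedCalc_mul hS hid.continuousOn
        hid.continuousOn, boundedCalc_ofReal hS]
    rw [← h1]
    refine boundedCalc_congr hS fun x hx => ?_
    have hx' := real_spectrum_subset_Icc hS hR.isSelfAdjoint hRS hx
    have : 0 ≤ 1 - x ^ 2 := by nlinarith [hx'.1, hx'.2]
    simp only [sqrtOneSubSq, ← Complex.ofReal_mul, Real.mul_self_sqrt this]
    push_cast; ring

/-- The inverse `v(x) = x(1 + x²)^{-1/2}` of `uFun`. -/
def uFunInv (x : ℝ) : ℝ := x / Real.sqrt (1 + x ^ 2)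

lemma continuous_uFunInv : Continuous uFunInv :=
  continuous_id.div (by fun_prop) fun x => (Real.sqrt_pos.mpr (by positivity)).ne'

lemma uFunInv_uFun {x : ℝ} (hx : x ∈ Set.Ioo (-1 : ℝ) 1) : uFunInv (uFun x) = x := by
  have h : 0 < 1 - x ^ 2 := by nlinarith [hx.1, hx.2]
  have hs := Real.sqrt_pos.mpr h
  have e : 1 + (x / √(1 - x ^ 2)) ^ 2 = (√(1 - x ^ 2))⁻¹ ^ 2 := by
    rw [div_pow, inv_pow, Real.sq_sqrt h.le]
    field_simp
    ring
  rw [uFunInv, uFun, e, Real.sqrt_sq (by positivity)]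
  field_simp

lemma uFunInv_mem_Ioo (x : ℝ) : uFunInv x ∈ Set.Ioo (-1 : ℝ) 1 := by
  have hs : 0 < √(1 + x ^ 2) := Real.sqrt_pos.mpr (by positivity)
  refine abs_lt.mp ?_
  rw [uFunInv, abs_div, abs_of_pos hs, div_lt_one hs, ← Real.sqrt_sq_eq_abs]
  exact Real.sqrt_lt_sqrt (sq_nonneg x) (by linarith)

lemma uFun_uFunInv (x : ℝ) : uFun (uFunInv x) = x := by
  have h : 0 < 1 + x ^ 2 := by positivity
  have hs := Real.sqrt_pos.mpr h
  have e : 1 - (x / √(1 + x ^ 2)) ^ 2 = (√(1 + x ^ 2))⁻¹ ^ 2 := by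
    rw [div_pow, inv_pow, Real.sq_sqrt h.le]
    field_simp
    ring
  rw [uFunInv, uFun, e, Real.sqrt_sq (by positivity)]
  field_simp

lemma ofReal_sub_uFun_mul_sqrtOneSubSq_eq_zero_iff {x y : ℝ} (hx : x ∈ Set.Ioo (-1 : ℝ) 1)
    (hy : y ∈ Set.Icc (-1 : ℝ) 1) :
    (y : ℂ) - (uFun x : ℂ) * sqrtOneSubSq y = 0 ↔ y = x := by
  rw [sub_eq_zero]
  refine ⟨fun h => ?_, ?_⟩
  · have hy' : y ∈ Set.Ioo (-1 : ℝ) 1 := by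
      have hne : y ^ 2 ≠ 1 := fun h1 => by
        have : (y : ℂ) = 0 := by rw [h, sqrtOneSubSq, h1]; simp
        rw [Complex.ofReal_eq_zero] at this
        simp [this] at h1
      refine ⟨lt_of_le_of_ne hy.1 ?_, lt_of_le_of_ne hy.2 ?_⟩
      · rintro rfl; simp at hne
      · rintro rfl; simp at hne
    have : (uFun y : ℂ) = uFun x := by
      rw [ofReal_uFun y, h, mul_div_assoc, div_self (sqrtOneSubSq_ne_zero hy'), mul_one]
    rw [← uFunInv_uFun hy', Complex.ofReal_inj.mp this, uFunInv_uFun hx]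
  · rintro rfl
    rw [ofReal_uFun, div_mul_cancel₀ _ (sqrtOneSubSq_ne_zero hx)]

lemma MemCc.mul {f g : ℝ → ℂ} {Ω : Set ℝ} (hg : MemCc g Ω) (hf : ContinuousOn f Ω) :
    MemCc (fun x => f x * g x) Ω := by
  obtain ⟨hc, K, hK, hKΩ, h0⟩ := hg
  exact ⟨hf.mul hc, K, hK, hKΩ, fun x hx => by simp [h0 x hx]⟩

lemma MemCc.apply_eq_zero {g : ℝ → ℂ} {Ω : Set ℝ} (hg : MemCc g Ω) {x : ℝ} (hx : x ∉ Ω) :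
    g x = 0 := by
  obtain ⟨-, K, -, hKΩ, h0⟩ := hg
  exact h0 x fun h => hx (hKΩ h)

lemma MemCc.continuousOn_spectrum {S : H →L[ℂ] H} {g : ℝ → ℂ} (hg : MemCc g (tildeSpec S)) :
    ContinuousOn g (spectrum ℝ S) := by
  obtain ⟨hc, K, hK, hKΩ, h0⟩ := hg
  intro x hx
  by_cases hx1 : x ∈ Set.Ioo (-1 : ℝ) 1
  · exact (continuousWithinAt_inter (isOpen_Ioo.mem_nhds hx1)).mp (hc x ⟨hx, hx1⟩)
  · have hxK : Kᶜ ∈ nhds x := hK.isClosed.isOpen_compl.mem_nhds fun h => hx1 (hKΩ h).2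
    refine ContinuousAt.continuousWithinAt ?_
    exact continuousAt_const.congr (Filter.eventuallyEq_of_mem hxK fun y hy => (h0 y hy).symm)

lemma mem_pmapResolventSet_iff {S R : H →L[ℂ] H} {T : H →ₗ.[ℂ] H}
    (hdom : (T.domain : Set H) = Set.range R)
    (hTR : ∀ x : H, ∃ hx : R x ∈ T.domain, (T ⟨R x, hx⟩ : H) = S x)
    (hRinj : Function.Injective R) (z : ℂ) :
    z ∈ pmapResolventSet T ↔ IsUnit (S - z • R) := by
  constructor
  · rintro ⟨B, hB1, hB2⟩
    rw [ContinuousLinearMap.isUnit_iff_bijective]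
    refine ⟨(injective_iff_map_eq_zero _).mpr fun x hx => ?_, fun y => ?_⟩
    · obtain ⟨h, e⟩ := hTR x
      have := hB2 ⟨R x, h⟩
      rw [e] at this
      change B ((S - z • R) x) = R x at this
      rw [hx, map_zero, ← map_zero R] at this
      exact (hRinj this).symm
    · obtain ⟨h, e⟩ := hB1 y
      obtain ⟨w, hw⟩ : B y ∈ Set.range R := hdom ▸ h
      obtain ⟨hw', ew⟩ := hTR w
      refine ⟨w, ?_⟩
      simp only [← hw, ew] at e
      exact e
  · rintro ⟨D, hD⟩
    refine ⟨R * ↑D⁻¹, fun x => ?_, fun ψ => ?_⟩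
    · obtain ⟨h, e⟩ := hTR ((↑D⁻¹ : H →L[ℂ] H) x)
      refine ⟨h, ?_⟩
      have : (↑D * ↑D⁻¹ : H →L[ℂ] H) x = x := by rw [D.mul_inv]; rfl
      rw [hD] at this
      exact (congrArg (· - _) e).trans this
    · obtain ⟨w, hw⟩ : (ψ : H) ∈ Set.range R := hdom ▸ ψ.2
      obtain ⟨h, e⟩ := hTR w
      have hψ : ψ = ⟨R w, h⟩ := Subtype.ext hw.symm
      have : (↑D⁻¹ * ↑D : H →L[ℂ] H) w = w := by rw [D.inv_mul]; rfl
      rw [hD] at this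
      rw [hψ, e]
      exact congrArg R this

/-- `u` maps `σ̃(S)` onto `σ(T)`. -/
lemma uFun_mem_realSpec_iff {S R : H →L[ℂ] H} {T : H →ₗ.[ℂ] H} (hS : IsSelfAdjoint S)
    (hR : R.IsPositive) (hRS : R * R = 1 - S * S)
    (hdom : (T.domain : Set H) = Set.range R)
    (hTR : ∀ x : H, ∃ hx : R x ∈ T.domain, (T ⟨R x, hx⟩ : H) = S x)
    (hRinj : Function.Injective R) {x : ℝ} (hx : x ∈ Set.Ioo (-1 : ℝ) 1) :
    uFun x ∈ realSpec T ↔ x ∈ spectrum ℝ S := by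
  have hid : Continuous fun y : ℝ => (y : ℂ) := Complex.continuous_ofReal
  have hcalc : boundedCalc S (fun y => (y : ℂ) - (uFun x : ℂ) * sqrtOneSubSq y) =
      S - (uFun x : ℂ) • R := by
    rw [boundedCalc_sub (f := fun y => (y : ℂ)) (g := fun y => (uFun x : ℂ) * sqrtOneSubSq y)
      hS hid.continuousOn (continuous_const.mul continuous_sqrtOneSubSq).continuousOn,
      boundedCalc_const_mul hS _ continuous_sqrtOneSubSq.continuousOn, boundedCalc_ofReal hS,
      ← eq_boundedCalc_sqrtOneSubSq hS hR hRS]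
  change ¬ _ ↔ _
  rw [mem_pmapResolventSet_iff hdom hTR hRinj, ← hcalc, isUnit_boundedCalc_iff
    (f := fun y => (y : ℂ) - (uFun x : ℂ) * sqrtOneSubSq y) hS
    (hid.sub (continuous_const.mul continuous_sqrtOneSubSq)).continuousOn]
  have key : ∀ y ∈ spectrum ℝ S, (y : ℂ) - (uFun x : ℂ) * sqrtOneSubSq y = 0 ↔ y = x :=
    fun y hy => ofReal_sub_uFun_mul_sqrtOneSubSq_eq_zero_iff hx
      (real_spectrum_subset_Icc hS hR.isSelfAdjoint hRS hy)
  push Not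
  exact ⟨fun ⟨y, hy, h⟩ => (key y hy).mp h ▸ hy, fun h => ⟨x, h, (key x h).mpr rfl⟩⟩

lemma MemCc.compU {S : H →L[ℂ] H} {Ω : Set ℝ} {h : ℝ → ℂ} (hh : MemCc h Ω)
    (hΩ : ∀ x ∈ Set.Ioo (-1 : ℝ) 1, uFun x ∈ Ω ↔ x ∈ spectrum ℝ S) :
    MemCc (compU h) (tildeSpec S) := by
  obtain ⟨hc, K, hK, hKΩ, h0⟩ := hh
  refine ⟨?_, uFunInv '' K, hK.image continuous_uFunInv, ?_, fun x hx => ?_⟩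
  · have : ContinuousOn (fun x => h (uFun x)) (tildeSpec S) :=
      hc.comp (continuousOn_uFun.mono Set.inter_subset_right) fun x hx => (hΩ x hx.2).mpr hx.1
    exact this.congr fun x hx => if_pos hx.2
  · rintro _ ⟨k, hk, rfl⟩
    refine ⟨(hΩ _ (uFunInv_mem_Ioo k)).mp ?_, uFunInv_mem_Ioo k⟩
    rw [uFun_uFunInv]
    exact hKΩ hk
  · by_cases hx1 : x ∈ Set.Ioo (-1 : ℝ) 1
    · rw [_root_.compU, if_pos hx1]
      exact h0 _ fun hk => hx ⟨_, hk, uFunInv_uFun hx1⟩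
    · exact if_neg hx1

lemma compU_ofReal_mul (h : ℝ → ℂ) :
    compU (fun x => (x : ℂ) * h x) = fun x => (uFun x : ℂ) * compU h x := by
  ext x
  simp only [compU]
  split_ifs <;> simp

/-- `T g(S)ψ = (u · g)(S)ψ` for `g ∈ C_c(σ̃(S))`. -/
lemma apply_boundedCalc_of_memCc {S R : H →L[ℂ] H} {T : H →ₗ.[ℂ] H} (hS : IsSelfAdjoint S)
    (hR : R.IsPositive) (hRS : R * R = 1 - S * S)
    (hTR : ∀ x : H, ∃ hx : R x ∈ T.domain, (T ⟨R x, hx⟩ : H) = S x)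
    {g : ℝ → ℂ} (hg : MemCc g (tildeSpec S)) (ψ : H) :
    ∃ hm : boundedCalc S g ψ ∈ T.domain,
      T ⟨boundedCalc S g ψ, hm⟩ = boundedCalc S (fun x => (uFun x : ℂ) * g x) ψ := by
  have hk : MemCc (fun x => (sqrtOneSubSq x)⁻¹ * g x) (tildeSpec S) :=
    hg.mul (continuous_sqrtOneSubSq.continuousOn.inv₀ fun x hx => sqrtOneSubSq_ne_zero hx.2)
  have h1 : boundedCalc S g = R * boundedCalc S (fun x => (sqrtOneSubSq x)⁻¹ * g x) := by
    conv_rhs => rw [eq_boundedCalc_sqrtOneSubSq hS hR hRS]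
    rw [← boundedCalc_mul hS continuous_sqrtOneSubSq.continuousOn hk.continuousOn_spectrum]
    congr 1
    ext x
    by_cases hx : x ∈ tildeSpec S
    · rw [mul_inv_cancel_left₀ (sqrtOneSubSq_ne_zero hx.2)]
    · rw [hg.apply_eq_zero hx, mul_zero, mul_zero]
  have h2 : boundedCalc S (fun x => (uFun x : ℂ) * g x) =
      S * boundedCalc S (fun x => (sqrtOneSubSq x)⁻¹ * g x) := by
    conv_rhs => enter [1]; rw [← boundedCalc_ofReal hS]
    rw [← boundedCalc_mul hS Complex.continuous_ofReal.continuousOn hk.continuousOn_spectrum]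
    congr 1
    ext x
    rw [ofReal_uFun, div_eq_mul_inv, mul_assoc]
  rw [h1, h2]
  exact hTR _

lemma map_mem_ccSpan {S R : H →L[ℂ] H} (hS : IsSelfAdjoint S)
    (hR : R.IsPositive) (hRS : R * R = 1 - S * S) {v : H} (hv : v ∈ ccSpan S) :
    R v ∈ ccSpan S := by
  suffices ccSpan S ≤ (ccSpan S).comap (R : H →ₗ[ℂ] H) from this hv
  refine Submodule.span_le.mpr ?_
  rintro _ ⟨g, hg, ψ, rfl⟩
  refine Submodule.subset_span ⟨_, hg.mul continuous_sqrtOneSubSq.continuousOn, ψ, ?_⟩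
  rw [boundedCalc_mul hS continuous_sqrtOneSubSq.continuousOn hg.continuousOn_spectrum,
    ← eq_boundedCalc_sqrtOneSubSq hS hR hRS]
  rfl

lemma map_mem_closure_ccSpan {S R : H →L[ℂ] H} (hS : IsSelfAdjoint S)
    (hR : R.IsPositive) (hRS : R * R = 1 - S * S) (y : H) :
    R y ∈ closure (ccSpan S : Set H) := by
  rw [Metric.mem_closure_iff]
  intro δ hδ
  have hy : 0 < ‖y‖ + 1 := by positivity
  set ε := δ / (‖y‖ + 1) with hε
  have hεpos : 0 < ε := by positivity
  let q : ℝ → ℂ := fun x => (max (√(1 - x ^ 2) - ε) 0 : ℝ)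
  have hq : Continuous q := by fun_prop
  let p : ℝ → ℂ := (spectrum ℝ S).indicator q
  have hpq : Set.EqOn p q (spectrum ℝ S) := Set.eqOn_indicator
  have hp : MemCc p (tildeSpec S) := by
    refine ⟨(hq.continuousOn.congr hpq).mono Set.inter_subset_left,
      spectrum ℝ S ∩ {x | ε ≤ √(1 - x ^ 2)},
      (spectrum.isCompact S).inter_right (isClosed_le continuous_const (by fun_prop)),
      fun x hx => ⟨hx.1, ?_⟩, fun x hx => ?_⟩
    · have := Real.sqrt_pos.mp (hεpos.trans_le hx.2)
      exact abs_lt.mp ((sq_lt_one_iff_abs_lt_one x).mp (by linarith))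
    · by_cases hxs : x ∈ spectrum ℝ S
      · have : √(1 - x ^ 2) < ε := not_le.mp fun h => hx ⟨hxs, h⟩
        rw [hpq hxs]
        simp only [q]
        rw [max_eq_right (by linarith), Complex.ofReal_zero]
      · exact Set.indicator_of_notMem hxs _
  refine ⟨boundedCalc S p y, Submodule.subset_span ⟨p, hp, y, rfl⟩, ?_⟩
  have hnorm : ‖R - boundedCalc S p‖ ≤ ε := by
    rw [boundedCalc_congr hS hpq, eq_boundedCalc_sqrtOneSubSq hS hR hRS,
      ← boundedCalc_sub hS continuous_sqrtOneSubSq.continuousOn hq.continuousOn]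
    refine norm_cfc_le hεpos.le fun z _ => ?_
    simp only [sqrtOneSubSq, q, ← Complex.ofReal_sub, Complex.norm_real, Real.norm_eq_abs]
    have := Real.sqrt_nonneg (1 - z.re ^ 2)
    rw [abs_le]
    rcases max_cases (√(1 - z.re ^ 2) - ε) 0 with h | h <;> constructor <;> linarith
  calc dist (R y) (boundedCalc S p y) = ‖(R - boundedCalc S p) y‖ := dist_eq_norm _ _
    _ ≤ ε * ‖y‖ := ContinuousLinearMap.le_of_opNorm_le _ hnorm y
    _ < ε * (‖y‖ + 1) := by gcongr; linarith
    _ = δ := div_mul_cancel₀ _ hy.ne'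

/-- `id(T) = T`: the closure of the operator `id₀(T)` on `C*_c(S)H`, determined by
`id₀(T) h(T)ψ = (id·h)(T)ψ` for `h ∈ C_c(σ(T))`, equals `T`. -/
theorem idT_eq_T (T : H →ₗ.[ℂ] H) (S : H →L[ℂ] H)
    (hdense : Dense (T.domain : Set H)) (hsa : IsSelfAdjoint T)
    (hbt : IsBoundedTransform T S) :
    ∃ A : H →ₗ.[ℂ] H, IsF0 S (realSpec T) (fun x : ℝ => (x : ℂ)) A ∧
      A.IsClosable ∧ A.closure = T := by
  obtain ⟨hS, R, hR, hRS, hdom, hTR⟩ := hbt.isSelfAdjoint_and_inverse hsa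
  have hRinj : Function.Injective R := (injective_iff_map_eq_zero R).mpr fun x hx => by
    obtain ⟨h, e⟩ := hTR x
    have hSx : S x = 0 := by
      rw [← e, show (⟨R x, h⟩ : T.domain) = 0 from Subtype.ext hx]
      exact T.toFun.map_zero
    have : R (R x) = x - S (S x) := congrArg (· x) hRS
    rw [hx, hSx, map_zero, map_zero, sub_zero] at this
    exact this.symm
  have hle : ccSpan S ≤ T.domain := by
    refine Submodule.span_le.mpr ?_
    rintro _ ⟨g, hg, ψ, rfl⟩
    exact (apply_boundedCalc_of_memCc hS hR hRS hTR hg ψ).1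
  have hdomA : (T.domRestrict (ccSpan S)).domain = ccSpan S := inf_eq_left.mpr hle
  have hcl : (T.domRestrict (ccSpan S)).IsClosable :=
    hsa.isClosed.isClosable.leIsClosable LinearPMap.domRestrict_le
  refine ⟨T.domRestrict (ccSpan S), ⟨hdomA, fun h hh ψ => ?_⟩, hcl,
    LinearPMap.eq_of_eq_graph ?_⟩
  · have hg : MemCc (compU h) (tildeSpec S) := hh.compU fun x hx =>
      uFun_mem_realSpec_iff hS hR hRS hdom hTR hRinj hx
    obtain ⟨hm, e⟩ := apply_boundedCalc_of_memCc hS hR hRS hTR hg ψ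
    refine ⟨⟨Submodule.subset_span ⟨_, hg, ψ, rfl⟩, hm⟩, ?_⟩
    have e' : pmapCalc S (fun x => (x : ℂ) * h x) ψ = T ⟨boundedCalc S (compU h) ψ, hm⟩ := by
      rw [pmapCalc, compU_ofReal_mul, e]
    rw [e']
    exact LinearPMap.domRestrict_apply rfl
  · rw [← hcl.graph_closure_eq_closure_graph]
    refine le_antisymm (Submodule.topologicalClosure_minimal _
      (LinearPMap.le_graph_of_le LinearPMap.domRestrict_le) hsa.isClosed) ?_
    rintro ⟨a, b⟩ hab
    obtain ⟨⟨a, ha⟩, rfl, rfl⟩ := (LinearPMap.mem_graph_iff T).mp hab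
    obtain ⟨x, rfl⟩ : a ∈ Set.range R := hdom ▸ SetLike.mem_coe.mpr ha
    obtain ⟨_, e⟩ := hTR x
    have hx : x ∈ closure (ccSpan S : Set H) := by
      refine closure_minimal ?_ isClosed_closure (hdense x)
      rw [hdom]
      rintro _ ⟨y, rfl⟩
      exact map_mem_closure_ccSpan hS hR hRS y
    simp only [e]
    refine map_mem_closure (f := fun v => (R v, S v)) (R.continuous.prodMk S.continuous) hx
      fun v hv => ?_
    obtain ⟨hv1, ev⟩ := hTR v
    refine (LinearPMap.mem_graph_iff _).mpr ⟨⟨R v, map_mem_ccSpan hS hR hRS hv, hv1⟩, rfl, ?_⟩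
    exact (LinearPMap.domRestrict_apply rfl).trans ev
end
end

section
/- Let T be a densely defined self-adjoint operator on a complex Hilbert space H with bounded transform S, σ̃(S) = σ(S) ∩ (-1,1), and u(x) = x(1 - x²)^{-1/2}. The map f ↦ f(T) := (f∘u)(S), defined via the Borel functional calculus for S, is a norm-decreasing *-homomorphism from the algebra B_b(σ(T)) of bounded Borel functions on σ(T) (with supremum norm) into the von Neumann algebra W*(T) = {T}''. -/
noncomputable section

variable {H : Type*} [NormedAddCommGroup H] [InnerProductSpace ℂ H] [CompleteSpace H]

/-- `Φ` is the Borel functional calculus of the bounded self-adjoint operator `S`: it agrees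
with the continuous functional calculus, depends only on values on `σ(S)`, is a
*-homomorphism on bounded Borel functions, and is sequentially strongly continuous under
uniformly bounded pointwise convergence.  These properties determine `Φ` uniquely on
bounded Borel functions. -/
def IsBorelFC (S : H →L[ℂ] H) (Φ : (ℝ → ℂ) → (H →L[ℂ] H)) : Prop :=
  (∀ f : ℝ → ℂ, ContinuousOn f (spectrum ℝ S) → Φ f = boundedCalc S f) ∧
  (∀ f g : ℝ → ℂ, (∀ x ∈ spectrum ℝ S, f x = g x) → Φ f = Φ g) ∧
  (∀ f g : ℝ → ℂ, Measurable f → Measurable g →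
    (∃ M, ∀ x ∈ spectrum ℝ S, ‖f x‖ ≤ M) → (∃ M, ∀ x ∈ spectrum ℝ S, ‖g x‖ ≤ M) →
    Φ (fun x => f x + g x) = Φ f + Φ g ∧ Φ (fun x => f x * g x) = Φ f * Φ g) ∧
  (∀ f : ℝ → ℂ, Measurable f → (∃ M, ∀ x ∈ spectrum ℝ S, ‖f x‖ ≤ M) →
    (∀ c : ℂ, Φ (fun x => c * f x) = c • Φ f) ∧
    Φ (fun x => starRingEnd ℂ (f x)) = star (Φ f)) ∧
  (∀ (f : ℕ → ℝ → ℂ) (g : ℝ → ℂ), (∀ n, Measurable (f n)) → Measurable g →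
    (∃ M, ∀ n, ∀ x ∈ spectrum ℝ S, ‖f n x‖ ≤ M) →
    (∀ x ∈ spectrum ℝ S, Filter.Tendsto (fun n => f n x) Filter.atTop (nhds (g x))) →
    ∀ ψ : H, Filter.Tendsto (fun n => Φ (f n) ψ) Filter.atTop (nhds (Φ g ψ)))

open Filter MeasureTheory Topology

set_option linter.unusedSectionVars false

/-! ### The bounded transform -/

section BoundedTransform

theorem inner_eq_of_mem_graph {T : H →ₗ.[ℂ] H} (hdense : Dense (T.domain : Set H))
    (hsa : IsSelfAdjoint T) {a b c d : H} (hab : (a, b) ∈ T.graph) (hcd : (c, d) ∈ T.graph) :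
    inner ℂ b c = inner ℂ a d := by
  have h := LinearPMap.adjoint_isFormalAdjoint (T := T) hdense
  rw [LinearPMap.isSelfAdjoint_def.mp hsa] at h
  rw [LinearPMap.mem_graph_iff] at hab hcd
  obtain ⟨x, rfl, rfl⟩ := hab
  obtain ⟨y, rfl, rfl⟩ := hcd
  exact h x y

theorem eq_zero_of_mem_graph_of_mem_graph_neg {T : H →ₗ.[ℂ] H}
    (hdense : Dense (T.domain : Set H)) (hsa : IsSelfAdjoint T) {v w : H}
    (hvw : (v, w) ∈ T.graph) (hwv : (w, -v) ∈ T.graph) : v = 0 := by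
  have h := inner_eq_of_mem_graph hdense hsa hvw hwv
  rw [inner_neg_right, inner_self_eq_norm_sq_to_K, inner_self_eq_norm_sq_to_K] at h
  have h' : ‖w‖ ^ 2 = -‖v‖ ^ 2 := by
    have := congrArg Complex.re h
    norm_cast at this
  have : ‖v‖ ^ 2 = 0 := by nlinarith [sq_nonneg ‖v‖, sq_nonneg ‖w‖]
  simpa using this

theorem CommutesPMap.mem_graph {T : H →ₗ.[ℂ] H} {A : H →L[ℂ] H} (hA : CommutesPMap T A)
    {a b : H} (hab : (a, b) ∈ T.graph) : (A a, A b) ∈ T.graph := by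
  rw [LinearPMap.mem_graph_iff] at hab
  obtain ⟨x, rfl, rfl⟩ := hab
  obtain ⟨h, hx⟩ := hA x
  exact (LinearPMap.mem_graph_iff _).mpr ⟨⟨_, h⟩, rfl, hx⟩

theorem commutesPMap_of_mem_graph {T : H →ₗ.[ℂ] H} {A : H →L[ℂ] H}
    (hA : ∀ a b, (a, b) ∈ T.graph → (A a, A b) ∈ T.graph) : CommutesPMap T A := by
  intro ψ
  obtain ⟨y, hy, hy'⟩ := (LinearPMap.mem_graph_iff _).mp (hA _ _ (T.mem_graph ψ))
  simp only at hy hy'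
  have hd : A (ψ : H) ∈ T.domain := hy ▸ y.2
  refine ⟨hd, ?_⟩
  rw [← hy']
  exact congrArg T (Subtype.ext hy.symm)

/-- `C = (1 + T²)⁻¹`. -/
def IsInvOneAddSq (T : H →ₗ.[ℂ] H) (C : H →L[ℂ] H) : Prop :=
  ∀ x, ∃ y, (C x, y) ∈ T.graph ∧ (y, x - C x) ∈ T.graph

theorem IsInvOneAddSq.eq_apply {T : H →ₗ.[ℂ] H} {C : H →L[ℂ] H} (hC : IsInvOneAddSq T C)
    (hdense : Dense (T.domain : Set H)) (hsa : IsSelfAdjoint T) {a b x : H}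
    (hab : (a, b) ∈ T.graph) (hbx : (b, x - a) ∈ T.graph) : a = C x := by
  obtain ⟨y, h1, h2⟩ := hC x
  have e1 := T.graph.sub_mem hab h1
  have e2 := T.graph.sub_mem hbx h2
  rw [Prod.mk_sub_mk] at e1 e2
  have : x - a - (x - C x) = -(a - C x) := by abel
  rw [this] at e2
  exact sub_eq_zero.mp (eq_zero_of_mem_graph_of_mem_graph_neg hdense hsa e1 e2)

theorem IsInvOneAddSq.commute_of_commutesPMap {T : H →ₗ.[ℂ] H} {C : H →L[ℂ] H}
    (hC : IsInvOneAddSq T C) (hdense : Dense (T.domain : Set H)) (hsa : IsSelfAdjoint T)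
    {A : H →L[ℂ] H} (hA : CommutesPMap T A) : Commute C A := by
  ext x
  obtain ⟨y, h1, h2⟩ := hC x
  have h2' := hA.mem_graph h2
  rw [map_sub] at h2'
  exact (hC.eq_apply hdense hsa (hA.mem_graph h1) h2').symm

theorem IsInvOneAddSq.commutesPMap {T : H →ₗ.[ℂ] H} {C : H →L[ℂ] H}
    (hC : IsInvOneAddSq T C) (hdense : Dense (T.domain : Set H)) (hsa : IsSelfAdjoint T) :
    CommutesPMap T C := by
  refine commutesPMap_of_mem_graph fun ψ φ h => ?_
  obtain ⟨y, h1, h2⟩ := hC ψ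
  have h3 := T.graph.sub_mem h h1
  rw [Prod.mk_sub_mk] at h3
  rw [← hC.eq_apply hdense hsa h2 h3]
  exact h1

theorem IsInvOneAddSq.injective {T : H →ₗ.[ℂ] H} {C : H →L[ℂ] H}
    (hC : IsInvOneAddSq T C) : Function.Injective C := by
  refine (injective_iff_map_eq_zero C).mpr fun x hx => ?_
  obtain ⟨y, h1, h2⟩ := hC x
  rw [hx] at h1 h2
  have hy : y = 0 := T.graph_fst_eq_zero_snd h1 rfl
  rw [sub_zero] at h2
  exact T.graph_fst_eq_zero_snd h2 hy

theorem Commute.of_mul_self_of_isPositive {A R : H →L[ℂ] H} (hR : R.IsPositive)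
    (h : Commute (R * R) A) : Commute R A := by
  have hR0 : 0 ≤ R := ContinuousLinearMap.nonneg_iff_isPositive R |>.mpr hR
  rw [← CFC.sqrt_mul_self R hR0]
  exact h.cfcₙ_nnreal _

/-- The algebraic relations between `S = T(1 + T²)^{-1/2}` and `R = (1 + T²)^{-1/2}`. -/
theorem IsBoundedTransform.exists_sqrt {T : H →ₗ.[ℂ] H} {S : H →L[ℂ] H}
    (hbt : IsBoundedTransform T S) (hdense : Dense (T.domain : Set H)) (hsa : IsSelfAdjoint T) :
    ∃ R : H →L[ℂ] H, R.IsPositive ∧ IsSelfAdjoint S ∧ S * S = 1 - R * R ∧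
      (∀ x, (R x, S x) ∈ T.graph) ∧ (∀ A, CommutesPMap T A → Commute R A) := by
  obtain ⟨C, R, -, hR, hRC, hC', hS'⟩ := hbt
  have hC : IsInvOneAddSq T C := by
    intro x
    obtain ⟨h1, h2, h3⟩ := hC' x
    refine ⟨T ⟨C x, h1⟩, T.mem_graph ⟨C x, h1⟩,
      (LinearPMap.mem_graph_iff _).mpr ⟨⟨_, h2⟩, rfl, eq_sub_of_add_eq' h3⟩⟩
  have hS : ∀ x, (R x, S x) ∈ T.graph := by
    intro x
    obtain ⟨h, hx⟩ := hS' x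
    rw [hx]
    exact T.mem_graph ⟨R x, h⟩
  have hRA : ∀ A, CommutesPMap T A → Commute R A := fun A hA =>
    Commute.of_mul_self_of_isPositive hR (hRC ▸ hC.commute_of_commutesPMap hdense hsa hA)
  have hRsa : star R = R := hR.isSelfAdjoint
  have hCsa : star C = C := by rw [← hRC, star_mul, hRsa]
  have hRRx : ∀ x, R (R x) = C x := fun x => by rw [← hRC]; rfl
  have hCinj := hC.injective
  have hRinj : Function.Injective R := fun x y h =>
    hCinj (by rw [← hRRx, ← hRRx, h])
  have cancel : ∀ {P A B : H →L[ℂ] H}, Function.Injective P → P * A = P * B → A = B := by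
    intro P A B hP h
    ext x
    exact hP (DFunLike.congr_fun h x)
  have hD : ∀ x, (C x, (S * R) x) ∈ T.graph := fun x => by
    rw [← hRRx]
    exact hS (R x)
  have hCD : C * (S * R) = S * R * C := by
    ext x
    exact T.mem_graph_snd_inj ((hC.commutesPMap hdense hsa).mem_graph (hD x)) (hD (C x)) rfl
  have hDC : C * (S * R) = star (S * R) * C := by
    ext x
    refine ext_inner_right ℂ fun y => ?_
    have h1 := inner_eq_of_mem_graph hdense hsa (hD x) (hD y)
    simp only [mul_apply_eq_comp, ContinuousLinearMap.star_eq_adjoint] at h1 ⊢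
    rw [← mul_apply_eq_comp S R, ContinuousLinearMap.adjoint_inner_left,
      ← ContinuousLinearMap.adjoint_inner_right, ← ContinuousLinearMap.star_eq_adjoint, hCsa]
    exact h1
  have hDsa : star (S * R) = S * R := by
    have h1 := congrArg star (hCD.symm.trans hDC)
    rw [star_mul (S * R) C, star_mul (star (S * R)) C, star_star, hCsa] at h1
    exact cancel hCinj h1
  have hDR : R * (S * R) = S * R * R :=
    Commute.of_mul_self_of_isPositive hR (hRC ▸ hCD)
  have hSR : S * R = R * star S := by
    rw [← hDsa, star_mul, hRsa]
  have h1 : star S * R = S * R := by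
    refine cancel hRinj ?_
    rw [← mul_assoc, ← hSR, hDR]
  have hSsa : star S = S := by
    have h2 := congrArg star h1
    rw [star_mul, star_mul, star_star, hRsa] at h2
    exact (cancel hRinj h2).symm
  have hcomm : S * R = R * S := by rw [hSR, hSsa]
  refine ⟨R, hR, hSsa, ?_, hS, hRA⟩
  ext x
  obtain ⟨y, h2, h3⟩ := hC x
  have hy : y = R (S x) :=
    (T.mem_graph_snd_inj h2 (hD x) rfl).trans (DFunLike.congr_fun hcomm x)
  rw [hRC]
  exact T.mem_graph_snd_inj (hS (S x)) h3 hy.symm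

theorem IsBoundedTransform.commute_of_commutesPMap {T : H →ₗ.[ℂ] H} {S : H →L[ℂ] H}
    (hbt : IsBoundedTransform T S) (hdense : Dense (T.domain : Set H)) (hsa : IsSelfAdjoint T)
    {A : H →L[ℂ] H} (hA : CommutesPMap T A) : Commute S A := by
  obtain ⟨R, -, -, -, hS, hRA⟩ := hbt.exists_sqrt hdense hsa
  ext x
  exact T.mem_graph_snd_inj (hS (A x)) (hA.mem_graph (hS x)) (DFunLike.congr_fun (hRA A hA) x)

theorem isUnit_algebraMap_add_of_isPositive {R : H →L[ℂ] H} (hR : R.IsPositive) {s : ℝ}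
    (hs : 0 < s) : IsUnit (algebraMap ℝ (H →L[ℂ] H) s + R) := by
  have hR0 : 0 ≤ R := ContinuousLinearMap.nonneg_iff_isPositive R |>.mpr hR
  by_contra h
  have h' : -s ∈ spectrum ℝ R := by
    rw [spectrum.mem_iff]
    intro hu
    apply h
    rw [← IsUnit.neg_iff]
    convert hu using 1
    rw [map_neg, neg_add]
    abel
  have := spectrum_nonneg_of_nonneg hR0 h'
  linarith

theorem isUnit_of_isSelfAdjoint_of_mul_eq_one {A L : H →L[ℂ] H} (hA : IsSelfAdjoint A)
    (h : L * A = 1) : IsUnit A := by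
  have h' : A * star L = 1 := by
    simpa [hA.star_eq] using congrArg star h
  have e := left_inv_eq_right_inv h h'
  exact ⟨⟨A, L, e ▸ h', h⟩, rfl⟩

theorem IsBoundedTransform.uFun_mem_realSpec {T : H →ₗ.[ℂ] H} {S : H →L[ℂ] H}
    (hbt : IsBoundedTransform T S) (hdense : Dense (T.domain : Set H)) (hsa : IsSelfAdjoint T)
    {x : ℝ} (hx : x ∈ tildeSpec S) : uFun x ∈ realSpec T := by
  obtain ⟨R, hR, hSsa, hSS, hS, -⟩ := hbt.exists_sqrt hdense hsa
  obtain ⟨hxS, hx1, hx2⟩ := hx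
  rintro ⟨B, -, hB⟩
  apply spectrum.mem_iff.mp hxS
  have hpos : 0 < 1 - x ^ 2 := by nlinarith
  set s := Real.sqrt (1 - x ^ 2) with hs
  have hspos : 0 < s := Real.sqrt_pos.mpr hpos
  have hs2 : s * s = 1 - x ^ 2 := Real.mul_self_sqrt hpos.le
  set l := uFun x with hl
  have hls : l * s = x := by
    rw [hl, uFun, ← hs]
    field_simp
  have hBQ : B * (S - l • R) = R := by
    ext v
    obtain ⟨w, hw, hw'⟩ := (LinearPMap.mem_graph_iff _).mp (hS v)
    have h1 := hB w
    simp only at hw hw'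
    rw [hw, hw'] at h1
    rw [← h1]
    simp
  obtain ⟨U, hU⟩ := isUnit_algebraMap_add_of_isPositive hR hspos
  set V : H →L[ℂ] H := ↑U⁻¹
  have hVU : V * (algebraMap ℝ (H →L[ℂ] H) s + R) = 1 := by
    rw [← hU]
    exact U.inv_mul
  have hfac : (algebraMap ℝ (H →L[ℂ] H) s + R) * (algebraMap ℝ (H →L[ℂ] H) s - R)
      = (S + algebraMap ℝ (H →L[ℂ] H) x) * (S - algebraMap ℝ (H →L[ℂ] H) x) := by
    have h1 : (algebraMap ℝ (H →L[ℂ] H) s + R) * (algebraMap ℝ (H →L[ℂ] H) s - R)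
        = (s * s) • 1 - R * R := by
      simp only [Algebra.algebraMap_eq_smul_one, add_mul, mul_sub, smul_mul_assoc,
        mul_smul_comm, one_mul, mul_one]
      module
    have h2 : (S + algebraMap ℝ (H →L[ℂ] H) x) * (S - algebraMap ℝ (H →L[ℂ] H) x)
        = S * S - (x * x) • 1 := by
      simp only [Algebra.algebraMap_eq_smul_one, add_mul, mul_sub, smul_mul_assoc,
        mul_smul_comm, one_mul, mul_one]
      module
    rw [h1, h2, hSS, hs2]
    module
  have hsR : algebraMap ℝ (H →L[ℂ] H) s - R
      = V * (S + algebraMap ℝ (H →L[ℂ] H) x) * (S - algebraMap ℝ (H →L[ℂ] H) x) := by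
    rw [mul_assoc, ← hfac, ← mul_assoc, hVU, one_mul]
  have hQ : S - l • R = (1 + l • (V * (S + algebraMap ℝ (H →L[ℂ] H) x))) *
      (S - algebraMap ℝ (H →L[ℂ] H) x) := by
    rw [add_mul, one_mul, smul_mul_assoc, ← hsR, smul_sub,
      Algebra.algebraMap_eq_smul_one, Algebra.algebraMap_eq_smul_one, smul_smul, hls]
    abel
  set E := 1 + l • (V * (S + algebraMap ℝ (H →L[ℂ] H) x))
  have hL : (R * B * E + (S + algebraMap ℝ (H →L[ℂ] H) x)) * (S - algebraMap ℝ (H →L[ℂ] H) x)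
      = algebraMap ℝ (H →L[ℂ] H) (s * s) := by
    rw [add_mul, mul_assoc, ← hQ, mul_assoc, hBQ, ← hfac]
    simp only [Algebra.algebraMap_eq_smul_one, add_mul, mul_sub, smul_mul_assoc,
      mul_smul_comm, one_mul, mul_one]
    module
  have hunit : IsUnit (S - algebraMap ℝ (H →L[ℂ] H) x) := by
    refine isUnit_of_isSelfAdjoint_of_mul_eq_one
      (L := (s * s)⁻¹ • (R * B * E + (S + algebraMap ℝ (H →L[ℂ] H) x)))
      (hSsa.sub (IsSelfAdjoint.algebraMap _ (IsSelfAdjoint.all x))) ?_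
    rw [smul_mul_assoc, hL, Algebra.algebraMap_eq_smul_one, smul_smul,
      inv_mul_cancel₀ (by positivity), one_smul]
  rw [← IsUnit.neg_iff, neg_sub]
  exact hunit

end BoundedTransform

/-! ### Borel functional calculus -/

section BorelCalculus

namespace IsBorelFC

variable {S : H →L[ℂ] H} {Φ : (ℝ → ℂ) → (H →L[ℂ] H)}

theorem map_one (hΦ : IsBorelFC S Φ) (hS : IsSelfAdjoint S) : Φ (fun _ => 1) = 1 := by
  rw [hΦ.1 _ continuousOn_const, boundedCalc]
  have := hS.isStarNormal
  exact cfc_const_one ℂ S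

theorem norm_le (hΦ : IsBorelFC S Φ) (hS : IsSelfAdjoint S) {h : ℝ → ℂ} (hh : Measurable h)
    {M : ℝ} (hM : 0 ≤ M) (hb : ∀ x ∈ spectrum ℝ S, ‖h x‖ ≤ M) : ‖Φ h‖ ≤ M := by
  obtain ⟨-, hcongr, hring, hstar, -⟩ := id hΦ
  set k : ℝ → ℂ := fun x => (Real.sqrt (M ^ 2 - ‖h x‖ ^ 2) : ℝ) with hk
  have hkm : Measurable k := by fun_prop
  have hkb : ∃ N, ∀ x ∈ spectrum ℝ S, ‖k x‖ ≤ N := by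
    refine ⟨M, fun x _ => ?_⟩
    rw [hk, Complex.norm_real, Real.norm_eq_abs, abs_of_nonneg (Real.sqrt_nonneg _)]
    exact Real.sqrt_le_iff.mpr ⟨hM, by nlinarith [sq_nonneg ‖h x‖]⟩
  have hmod : ∀ p : ℝ → ℂ, Measurable p → (∃ N, ∀ x ∈ spectrum ℝ S, ‖p x‖ ≤ N) →
      Measurable (fun x => starRingEnd ℂ (p x) * p x) ∧
      (∃ N, ∀ x ∈ spectrum ℝ S, ‖starRingEnd ℂ (p x) * p x‖ ≤ N) ∧
      Φ (fun x => starRingEnd ℂ (p x) * p x) = star (Φ p) * Φ p := by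
    rintro p hp ⟨N, hN⟩
    have hps : Measurable (fun x => starRingEnd ℂ (p x)) := by fun_prop
    refine ⟨hps.mul hp, ⟨N * N, fun x hx => ?_⟩, ?_⟩
    · rw [norm_mul, RCLike.norm_conj]
      exact mul_self_le_mul_self (norm_nonneg _) (hN x hx)
    · rw [(hring _ _ hps hp ⟨N, by simpa using hN⟩ ⟨N, hN⟩).2, (hstar p hp ⟨N, hN⟩).2]
  obtain ⟨hm1, hb1, e1⟩ := hmod h hh ⟨M, hb⟩
  obtain ⟨hm2, hb2, e2⟩ := hmod k hkm hkb
  have hsum : star (Φ h) * Φ h + star (Φ k) * Φ k = ((M : ℂ) ^ 2) • (1 : H →L[ℂ] H) := by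
    rw [← e1, ← e2, ← (hring _ _ hm1 hm2 hb1 hb2).1, ← hΦ.map_one hS,
      ← (hstar (fun _ => 1) measurable_const ⟨1, by simp⟩).1]
    refine hcongr _ _ fun x hx => ?_
    have hx' := hb x hx
    have hn : 0 ≤ M ^ 2 - ‖h x‖ ^ 2 := by nlinarith [norm_nonneg (h x)]
    rw [← Complex.normSq_eq_conj_mul_self, ← Complex.normSq_eq_conj_mul_self,
      Complex.normSq_eq_norm_sq, hk, Complex.normSq_ofReal, Real.mul_self_sqrt hn]
    push_cast
    ring
  refine ContinuousLinearMap.opNorm_le_bound _ hM fun v => ?_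
  have hv := congrArg (fun A : H →L[ℂ] H => (inner ℂ (A v) v).re) hsum
  have hn : ∀ A : H →L[ℂ] H, (inner ℂ ((star A * A) v) v).re = ‖A v‖ ^ 2 := by
    intro A
    rw [mul_apply_eq_comp, ContinuousLinearMap.star_eq_adjoint,
      ContinuousLinearMap.adjoint_inner_left, inner_self_eq_norm_sq_to_K]
    norm_cast
  have hv' : ‖Φ h v‖ ^ 2 + ‖Φ k v‖ ^ 2 = M ^ 2 * ‖v‖ ^ 2 := by
    rw [← hn, ← hn, ← Complex.add_re, ← inner_add_left]
    refine hv.trans ?_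
    simp only [_root_.smul_apply, one_apply_eq_self, inner_smul_left,
      inner_self_eq_norm_sq_to_K]
    simp
    norm_cast
    ring
  refine le_of_sq_le_sq ?_ (by positivity)
  nlinarith [sq_nonneg ‖Φ k v‖]

theorem commute_of_tendsto (hΦ : IsBorelFC S Φ) {A : H →L[ℂ] H} {p : ℕ → ℝ → ℂ} {q : ℝ → ℂ}
    (hp : ∀ n, Measurable (p n)) (hq : Measurable q)
    (hb : ∃ M, ∀ n, ∀ x ∈ spectrum ℝ S, ‖p n x‖ ≤ M)
    (hlim : ∀ x ∈ spectrum ℝ S, Tendsto (fun n => p n x) atTop (𝓝 (q x)))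
    (hA : ∀ n, Commute A (Φ (p n))) : Commute A (Φ q) := by
  have hlim' := hΦ.2.2.2.2 p q hp hq hb hlim
  ext v
  refine tendsto_nhds_unique ((A.continuous.tendsto _).comp (hlim' v)) ?_
  refine (hlim' (A v)).congr fun n => ?_
  exact (DFunLike.congr_fun (hA n) v).symm

theorem commute_indicator (hΦ : IsBorelFC S Φ) (hS : IsSelfAdjoint S) {A : H →L[ℂ] H}
    (hA : Commute S A) {E : Set ℝ} (hE : MeasurableSet E) :
    Commute A (Φ (E.indicator fun _ => 1)) := by
  have hind : ∀ {E : Set ℝ}, MeasurableSet E →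
      Measurable (E.indicator fun _ => (1 : ℂ)) := fun hE => measurable_const.indicator hE
  have hle : ∀ (E : Set ℝ) (x : ℝ), ‖E.indicator (fun _ => (1 : ℂ)) x‖ ≤ 1 := fun E x =>
    (norm_indicator_le_norm_self _ _).trans (by simp)
  have hcont : ∀ p : ℝ → ℂ, Continuous p → Commute A (Φ p) := fun p hp => by
    rw [hΦ.1 p hp.continuousOn, boundedCalc]
    exact (hS.commute_cfc hA _).symm
  have hadd := fun p q hp hq hpb hqb => (hΦ.2.2.1 p q hp hq hpb hqb).1
  have hborel : (inferInstance : MeasurableSpace ℝ) =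
      MeasurableSpace.generateFrom {s : Set ℝ | IsClosed s} :=
    BorelSpace.measurable_eq.trans borel_eq_generateFrom_isClosed
  induction E, hE using MeasurableSpace.induction_on_inter hborel isPiSystem_isClosed with
  | empty =>
    rw [Set.indicator_empty]
    exact hcont _ continuous_const
  | basic F hF =>
    have hF : IsClosed F := hF
    have hc : ∀ n, Continuous fun x => (((hF.apprSeq n x : NNReal) : ℝ) : ℂ) := fun n => by
      have := (hF.apprSeq n).continuous
      fun_prop
    refine hΦ.commute_of_tendsto (p := fun n x => (((hF.apprSeq n x : NNReal) : ℝ) : ℂ))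
      (fun n => (hc n).measurable) (hind hF.measurableSet) ⟨1, fun n x _ => ?_⟩
      (fun x _ => ?_) fun n => hcont _ (hc n)
    · rw [Complex.norm_real, Real.norm_eq_abs, NNReal.abs_eq]
      exact_mod_cast HasOuterApproxClosed.apprSeq_apply_le_one hF n x
    · have h1 := tendsto_pi_nhds.mp (HasOuterApproxClosed.tendsto_apprSeq hF) x
      have hcoe : Continuous fun y : NNReal => ((y : ℝ) : ℂ) := by fun_prop
      have h2 := (hcoe.tendsto _).comp h1
      have e : F.indicator (fun _ => (1 : ℂ)) x =
          (((F.indicator (fun _ => 1) x : NNReal) : ℝ) : ℂ) := by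
        by_cases hx : x ∈ F <;> simp [hx]
      rw [e]
      exact h2
  | compl E hE ih =>
    have h1 := hadd _ _ (hind hE) (hind hE.compl) ⟨1, fun x _ => hle _ x⟩ ⟨1, fun x _ => hle _ x⟩
    have h2 : (fun x => E.indicator (fun _ => (1 : ℂ)) x + Eᶜ.indicator (fun _ => 1) x)
        = fun _ => 1 := Set.indicator_self_add_compl E _
    rw [h2] at h1
    rw [eq_sub_of_add_eq' h1.symm]
    exact (hcont _ continuous_const).sub_right ih
  | iUnion E hdisj hE ih =>
    have hunion : ∀ n, Commute A (Φ ((⋃ i < n, E i).indicator fun _ => 1)) := by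
      intro n
      induction n with
      | zero =>
        simp only [not_lt_zero, Set.iUnion_of_empty, Set.iUnion_empty, Set.indicator_empty]
        exact hcont _ continuous_const
      | succ n ihn =>
        have hd : Disjoint (⋃ i < n, E i) (E n) := by
          simp only [Set.disjoint_iUnion_left]
          exact fun i hi => hdisj hi.ne
        have hm : MeasurableSet (⋃ i < n, E i) :=
          MeasurableSet.iUnion fun i => MeasurableSet.iUnion fun _ => hE i
        rw [Set.biUnion_lt_succ, Set.indicator_union_of_disjoint hd,
          hadd _ _ (hind hm) (hind (hE n)) ⟨1, fun x _ => hle _ x⟩ ⟨1, fun x _ => hle _ x⟩]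
        exact ihn.add_right (ih n)
    refine hΦ.commute_of_tendsto (fun n => hind ?_) (hind (MeasurableSet.iUnion hE))
      ⟨1, fun n x _ => hle _ x⟩ (fun x _ => ?_) hunion
    · exact MeasurableSet.iUnion fun i => MeasurableSet.iUnion fun _ => hE i
    · by_cases hx : x ∈ ⋃ i, E i
      · obtain ⟨i, hi⟩ := Set.mem_iUnion.mp hx
        refine tendsto_const_nhds.congr' ?_
        filter_upwards [eventually_gt_atTop i] with n hn
        have hx' : x ∈ ⋃ i < n, E i := Set.mem_iUnion₂.mpr ⟨i, hn, hi⟩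
        rw [Set.indicator_of_mem hx, Set.indicator_of_mem hx']
      · refine tendsto_const_nhds.congr fun n => ?_
        rw [Set.indicator_of_notMem hx, Set.indicator_of_notMem]
        exact fun h => hx (Set.iUnion₂_subset_iUnion _ _ h)

theorem commute_simpleFunc (hΦ : IsBorelFC S Φ) (hS : IsSelfAdjoint S) {A : H →L[ℂ] H}
    (hA : Commute S A) (p : SimpleFunc ℝ ℂ) : Commute A (Φ p) := by
  induction p using SimpleFunc.induction with
  | const c hs =>
    have h1 := (hΦ.2.2.2.1 _ (measurable_const.indicator hs)
      ⟨1, fun x _ => (norm_indicator_le_norm_self (fun _ => (1 : ℂ)) x).trans (by simp)⟩).1 c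
    convert (hΦ.commute_indicator hS hA hs).smul_right c using 1
    rw [← h1]
    refine hΦ.2.1 _ _ fun x _ => ?_
    classical
    simp [Set.piecewise, Set.indicator]
  | @add p q _ hp hq =>
    have hb : ∀ r : SimpleFunc ℝ ℂ, ∃ M, ∀ x ∈ spectrum ℝ S, ‖r x‖ ≤ M := fun r => by
      obtain ⟨M, hM⟩ := r.exists_forall_norm_le
      exact ⟨M, fun x _ => hM x⟩
    have h1 := (hΦ.2.2.1 p q p.measurable q.measurable (hb p) (hb q)).1
    rw [SimpleFunc.coe_add]
    exact h1 ▸ hp.add_right hq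

theorem commute (hΦ : IsBorelFC S Φ) (hS : IsSelfAdjoint S) {A : H →L[ℂ] H}
    (hA : Commute S A) {h : ℝ → ℂ} (hh : Measurable h)
    (hb : ∃ M, ∀ x ∈ spectrum ℝ S, ‖h x‖ ≤ M) : Commute A (Φ h) := by
  obtain ⟨M, hM⟩ := hb
  have hsm := hh.stronglyMeasurable
  refine hΦ.commute_of_tendsto (p := fun n => hsm.approxBounded (max M 0) n)
    (fun n => SimpleFunc.measurable _) hh
    ⟨max M 0, fun n x _ => hsm.norm_approxBounded_le (le_max_right _ _) n x⟩
    (fun x hx => hsm.tendsto_approxBounded_of_norm_le ((hM x hx).trans (le_max_left _ _)))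
    fun n => hΦ.commute_simpleFunc hS hA _

end IsBorelFC

end BorelCalculus

theorem measurable_compU {h : ℝ → ℂ} (hh : Measurable h) : Measurable (compU h) := by
  have hu : Measurable uFun := by
    unfold uFun
    fun_prop
  exact Measurable.ite measurableSet_Ioo (hh.comp hu) measurable_const

theorem IsBoundedTransform.norm_compU_le {T : H →ₗ.[ℂ] H} {S : H →L[ℂ] H}
    (hbt : IsBoundedTransform T S) (hdense : Dense (T.domain : Set H)) (hsa : IsSelfAdjoint T)
    {h : ℝ → ℂ} {M : ℝ} (hM : 0 ≤ M) (hb : ∀ x ∈ realSpec T, ‖h x‖ ≤ M) :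
    ∀ x ∈ spectrum ℝ S, ‖compU h x‖ ≤ M := by
  intro x hx
  unfold compU
  split_ifs with hx'
  · exact hb _ (hbt.uFun_mem_realSpec hdense hsa ⟨hx, hx'⟩)
  · simpa using hM

/-- The Borel functional calculus `f ↦ f(T) = Φ((f∘u) extended by 0)` is a norm-decreasing
*-homomorphism from the bounded Borel functions on `σ(T)` into `W*(T) = {T}''`. -/
theorem borel_calc_starHom_into_wstar (T : H →ₗ.[ℂ] H) (S : H →L[ℂ] H)
    (hdense : Dense (T.domain : Set H)) (hsa : IsSelfAdjoint T)
    (hbt : IsBoundedTransform T S)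
    (Φ : (ℝ → ℂ) → (H →L[ℂ] H)) (hΦ : IsBorelFC S Φ)
    (f g : ℝ → ℂ) (hf : Measurable f) (hg : Measurable g)
    (hfb : ∃ M, ∀ x ∈ realSpec T, ‖f x‖ ≤ M) (hgb : ∃ M, ∀ x ∈ realSpec T, ‖g x‖ ≤ M)
    (c : ℂ) :
    Φ (compU (fun x => f x + g x)) = Φ (compU f) + Φ (compU g) ∧
    Φ (compU (fun x => f x * g x)) = Φ (compU f) * Φ (compU g) ∧
    Φ (compU (fun x => c * f x)) = c • Φ (compU f) ∧
    Φ (compU (fun x => starRingEnd ℂ (f x))) = star (Φ (compU f)) ∧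
    Φ (compU f) ∈ Set.centralizer {R : H →L[ℂ] H | CommutesPMap T R} ∧
    ‖Φ (compU f)‖ ≤ supNorm f (realSpec T) := by
  obtain ⟨R, -, hS, -⟩ := hbt.exists_sqrt hdense hsa
  have hbdd : ∀ h : ℝ → ℂ, (∃ M, ∀ x ∈ realSpec T, ‖h x‖ ≤ M) →
      ∃ M, ∀ x ∈ spectrum ℝ S, ‖compU h x‖ ≤ M := by
    rintro h ⟨M, hM⟩
    exact ⟨max M 0, hbt.norm_compU_le hdense hsa (le_max_right _ _)
      fun x hx => (hM x hx).trans (le_max_left _ _)⟩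
  have hfm := measurable_compU hf
  have hring := hΦ.2.2.1 _ _ hfm (measurable_compU hg) (hbdd f hfb) (hbdd g hgb)
  have hstar := hΦ.2.2.2.1 _ hfm (hbdd f hfb)
  refine ⟨?_, ?_, ?_, ?_, ?_, ?_⟩
  · rw [← hring.1]
    congr 1
    ext x
    simp only [compU]
    split_ifs <;> simp
  · rw [← hring.2]
    congr 1
    ext x
    simp only [compU]
    split_ifs <;> simp
  · rw [← hstar.1 c]
    congr 1
    ext x
    simp only [compU]
    split_ifs <;> simp
  · rw [← hstar.2]
    congr 1
    ext x
    simp only [compU]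
    split_ifs <;> simp
  · intro A hA
    exact hΦ.commute hS (hbt.commute_of_commutesPMap hdense hsa hA) hfm (hbdd f hfb)
  · have h0 : 0 ≤ supNorm f (realSpec T) := by
      refine Real.sSup_nonneg ?_
      rintro _ ⟨x, -, rfl⟩
      exact norm_nonneg _
    refine hΦ.norm_le hS hfm h0 (hbt.norm_compU_le hdense hsa h0 fun x hx => ?_)
    obtain ⟨M, hM⟩ := hfb
    refine le_csSup ⟨M, ?_⟩ ⟨x, hx, rfl⟩
    rintro _ ⟨y, hy, rfl⟩
    exact hM y hy
end
end
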